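/- Let T be a C_{p^r q^s}-transfer system, modeled on the grid Fin (r+1) × Fin (s+1). If T has three or more connected components (i.e. there exist three vertices that are pairwise in different connected components of T), then T is not lesser simply paired. -/

import Mathlib

/-- A `C_{p^r q^s}`-transfer system, modeled on the grid `Fin (r+1) × Fin (s+1)`
with the componentwise order and componentwise minimum `⊓`. -/
def IsGridTransferSystem {r s : ℕ}
    (T : Fin (r+1) × Fin (s+1) → Fin (r+1) × Fin (s+1) → Prop) : Prop :=
  (∀ v w, T v w → v ≤ w) ∧
  (∀ v, T v v) ∧
  (∀ u v w, T u v → T v w → T u w) ∧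
  (∀ v w u, T v w → T (v ⊓ u) (w ⊓ u))

/-- Two vertices are in the same connected component of `T` if they are related by
the reflexive-transitive closure of the symmetrization of `T`. -/
def GridSameComponent {r s : ℕ}
    (T : Fin (r+1) × Fin (s+1) → Fin (r+1) × Fin (s+1) → Prop)
    (v w : Fin (r+1) × Fin (s+1)) : Prop :=
  Relation.ReflTransGen (fun x y => T x y ∨ T y x) v w

/-- `(T, T')` is a compatible pair of grid transfer systems. -/
def GridCompatible {r s : ℕ}
    (T T' : Fin (r+1) × Fin (s+1) → Fin (r+1) × Fin (s+1) → Prop) : Prop :=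
  (∀ v w, T v w → T' v w) ∧
  ∀ A B C : Fin (r+1) × Fin (s+1), B ≤ A → C ≤ A → T B A → T' (B ⊓ C) B → T' C A

/-- A grid transfer system is saturated if `u ≤ v ≤ w` and `T u w` imply `T v w`. -/
def GridSaturated {r s : ℕ}
    (T : Fin (r+1) × Fin (s+1) → Fin (r+1) × Fin (s+1) → Prop) : Prop :=
  ∀ u v w : Fin (r+1) × Fin (s+1), u ≤ v → v ≤ w → T u w → T v w

/-- `Th` is a saturated hull of `T`. -/
def GridSaturatedHull {r s : ℕ}
    (T Th : Fin (r+1) × Fin (s+1) → Fin (r+1) × Fin (s+1) → Prop) : Prop :=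
  IsGridTransferSystem Th ∧ GridSaturated Th ∧ (∀ v w, T v w → Th v w) ∧
  ∀ T'' : Fin (r+1) × Fin (s+1) → Fin (r+1) × Fin (s+1) → Prop,
    IsGridTransferSystem T'' → GridSaturated T'' →
    (∀ v w, T v w → T'' v w) → (∀ v w, Th v w → T'' v w)

/-- `T` is lesser simply paired. -/
def GridLesserSimplyPaired {r s : ℕ}
    (T : Fin (r+1) × Fin (s+1) → Fin (r+1) × Fin (s+1) → Prop) : Prop :=
  ∀ T' : Fin (r+1) × Fin (s+1) → Fin (r+1) × Fin (s+1) → Prop,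
    IsGridTransferSystem T' → (∀ v w, T v w → T' v w) →
    (GridCompatible T T' ↔ (GridSaturatedHull T T' ∨ T' = fun v w => v ≤ w))

/-- `T` has exactly two connected components: `(0,0)` and `(r,s)` are in different
components and every vertex is in the component of one of them. -/
def GridTwoComponents {r s : ℕ}
    (T : Fin (r+1) × Fin (s+1) → Fin (r+1) × Fin (s+1) → Prop) : Prop :=
  ¬ GridSameComponent T (0, 0) (Fin.last r, Fin.last s) ∧
  ∀ v, GridSameComponent T (0, 0) v ∨ GridSameComponent T (Fin.last r, Fin.last s) v

namespace GridSameComponent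

variable {r s : ℕ} {T : Fin (r+1) × Fin (s+1) → Fin (r+1) × Fin (s+1) → Prop}
  {x y z : Fin (r+1) × Fin (s+1)}

theorem refl (x : Fin (r+1) × Fin (s+1)) : GridSameComponent T x x :=
  Relation.ReflTransGen.refl

theorem symm (h : GridSameComponent T x y) : GridSameComponent T y x :=
  have : Std.Symm fun x y => T x y ∨ T y x := ⟨fun _ _ => Or.symm⟩
  Relation.ReflTransGen.stdSymm.symm _ _ h

theorem trans (h : GridSameComponent T x y) (h' : GridSameComponent T y z) :
    GridSameComponent T x z :=
  Relation.ReflTransGen.trans h h'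

theorem of_rel (h : T x y) : GridSameComponent T x y :=
  Relation.ReflTransGen.single (Or.inl h)

theorem inf_right (hT : IsGridTransferSystem T) (h : GridSameComponent T x y)
    (u : Fin (r+1) × Fin (s+1)) : GridSameComponent T (x ⊓ u) (y ⊓ u) :=
  Relation.ReflTransGen.lift (· ⊓ u)
    (fun _ _ => Or.imp (hT.2.2.2 _ _ u) (hT.2.2.2 _ _ u)) _ _ h

/-- The components of a grid transfer system are order-convex. -/
theorem of_le_of_le (hT : IsGridTransferSystem T) (h : GridSameComponent T x z)
    (hxy : x ≤ y) (hyz : y ≤ z) : GridSameComponent T y z := by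
  have h₁ := h.inf_right hT y
  rw [inf_eq_left.2 hxy, inf_eq_right.2 hyz] at h₁
  exact h₁.symm.trans h

end GridSameComponent

/-- The restriction of the order to the components of `T` is a transfer system. -/
theorem isGridTransferSystem_le_and_sameComponent {r s : ℕ}
    {T : Fin (r+1) × Fin (s+1) → Fin (r+1) × Fin (s+1) → Prop}
    (hT : IsGridTransferSystem T) :
    IsGridTransferSystem fun x y => x ≤ y ∧ GridSameComponent T x y :=
  ⟨fun _ _ h => h.1, fun x => ⟨le_rfl, .refl x⟩,
    fun _ _ _ h h' => ⟨h.1.trans h'.1, h.2.trans h'.2⟩,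
    fun _ _ u h => ⟨inf_le_inf_right u h.1, h.2.inf_right hT u⟩⟩

/-- The order relations not entering a filter `P` form a transfer system. -/
theorem isGridTransferSystem_le_and_imp {r s : ℕ} {P : Fin (r+1) × Fin (s+1) → Prop}
    (hP : ∀ x y, P (x ⊓ y) ↔ P x ∧ P y) :
    IsGridTransferSystem fun x y => x ≤ y ∧ (P y → P x) :=
  ⟨fun _ _ h => h.1, fun _ => ⟨le_rfl, id⟩,
    fun _ _ _ h h' => ⟨h.1.trans h'.1, h.2 ∘ h'.2⟩,
    fun _ _ u h => ⟨inf_le_inf_right u h.1, fun hu =>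
      (hP _ _).2 (((hP _ _).1 hu).imp_left h.2)⟩⟩

/-- Every saturated transfer system containing `T` is compatible with `T`. -/
theorem GridSaturated.gridCompatible {r s : ℕ}
    {T T' : Fin (r+1) × Fin (s+1) → Fin (r+1) × Fin (s+1) → Prop}
    (hs : GridSaturated T') (hT' : IsGridTransferSystem T')
    (hle : ∀ v w, T v w → T' v w) : GridCompatible T T' :=
  ⟨hle, fun _ _ _ _ hCA hBA h =>
    hs _ _ _ inf_le_right hCA (hT'.2.2.1 _ _ _ h (hle _ _ hBA))⟩

/-- In a lesser simply paired transfer system, every vertex lying outside the component of `⊥`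
determines the only other component. -/
theorem GridLesserSimplyPaired.sameComponent_of_not_bot {r s : ℕ}
    {T : Fin (r+1) × Fin (s+1) → Fin (r+1) × Fin (s+1) → Prop}
    (hT : IsGridTransferSystem T) (h : GridLesserSimplyPaired T)
    {m : Fin (r+1) × Fin (s+1)} (hm : ¬ GridSameComponent T ⊥ m)
    (x : Fin (r+1) × Fin (s+1)) :
    GridSameComponent T ⊥ x ∨ GridSameComponent T m x := by
  let P : Fin (r+1) × Fin (s+1) → Prop := fun x => GridSameComponent T (x ⊓ m) m
  have hP : ∀ x y, P (x ⊓ y) ↔ P x ∧ P y := by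
    intro x y
    refine ⟨fun hxy => ⟨?_, ?_⟩, fun ⟨hx, hy⟩ => ?_⟩
    · exact hxy.of_le_of_le hT (inf_le_inf_right m inf_le_left) inf_le_right
    · exact hxy.of_le_of_le hT (inf_le_inf_right m inf_le_right) inf_le_right
    · have h₁ := hx.inf_right hT y
      rw [inf_right_comm, inf_comm m y] at h₁
      exact h₁.trans hy
  have hPm : P m := by simpa [P] using GridSameComponent.refl m
  have hPbot : ¬ P ⊥ := by simpa [P] using hm
  have hT' := isGridTransferSystem_le_and_imp hP
  have hle : ∀ v w, T v w → v ≤ w ∧ (P w → P v) := fun v w hvw =>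
    ⟨hT.1 v w hvw, fun hw => ((GridSameComponent.of_rel hvw).inf_right hT m).trans hw⟩
  have hsat : GridSaturated fun x y => x ≤ y ∧ (P y → P x) := by
    intro a b c hab hbc hac
    refine ⟨hbc, fun hc => ((hP a b).1 ?_).2⟩
    rw [inf_eq_left.2 hab]
    exact hac.2 hc
  rcases (h _ hT' hle).1 (hsat.gridCompatible hT' hle) with hhull | heq
  · have key := hhull.2.2.2 _ (isGridTransferSystem_le_and_sameComponent hT)
      (fun a b c hab hbc hac => ⟨hbc, hac.2.of_le_of_le hT hab hbc⟩)
      (fun a b hab => ⟨hT.1 a b hab, .of_rel hab⟩)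
    by_cases hx : P x
    · have hxm : GridSameComponent T (x ⊓ m) x :=
        (key (x ⊓ m) x ⟨inf_le_left, fun _ => (hP x m).2 ⟨hx, hPm⟩⟩).2
      exact Or.inr (GridSameComponent.trans (GridSameComponent.symm hx) hxm)
    · exact Or.inl (key ⊥ x ⟨bot_le, fun hx' => absurd hx' hx⟩).2
  · have hbm : ⊥ ≤ m ∧ (P m → P ⊥) := by
      have := congrFun (congrFun heq ⊥) m
      exact this.mpr bot_le
    exact absurd (hbm.2 hPm) hPbot

/-- A grid transfer system with three or more connected components is not lesser
simply paired. -/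
theorem three_components_not_lsp {r s : ℕ}
    (T : Fin (r+1) × Fin (s+1) → Fin (r+1) × Fin (s+1) → Prop)
    (hT : IsGridTransferSystem T)
    (u v w : Fin (r+1) × Fin (s+1))
    (huv : ¬ GridSameComponent T u v) (huw : ¬ GridSameComponent T u w)
    (hvw : ¬ GridSameComponent T v w) :
    ¬ GridLesserSimplyPaired T := by
  intro h
  by_cases hu : GridSameComponent T ⊥ u
  · have hv : ¬ GridSameComponent T ⊥ v := fun hv => huv (hu.symm.trans hv)
    rcases h.sameComponent_of_not_bot hT hv w with hw | hw
    · exact huw (hu.symm.trans hw)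
    · exact hvw hw
  · rcases h.sameComponent_of_not_bot hT hu v with hv | hv
    · rcases h.sameComponent_of_not_bot hT hu w with hw | hw
      · exact hvw (hv.symm.trans hw)
      · exact huw hw
    · exact huv hv
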